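/- arXiv:1302.0348 — 3 statements merged into one kernel-verified Lean document; each statement's English description precedes it below -/
import Mathlib

section
/- Let ℓ be a prime, S a subset of F_ℓ, and n a positive integer. Let N(ℓ, S, n) denote the number of solutions (a, b, c, s, t) to the congruence a·s − b·t ≡ c (mod ℓ) with integers 1 ≤ a, b ≤ n, |c| ≤ n, and s, t ∈ S. Then for every ε > 0 there is a constant C = C(ε) such that N(ℓ, S, n) ≤ C · (ℓ^{−1} n^3 |S|^2 + ℓ^ε n^2 |S|). -/
open Finset Real

/-- The divisor bound `d(m) ≪ m ^ ε`. -/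
theorem exists_card_divisors_le_rpow (ε : ℝ) (hε : 0 < ε) :
    ∃ C : ℝ, 0 < C ∧ ∀ m : ℕ, m ≠ 0 → (#m.divisors : ℝ) ≤ C * (m : ℝ) ^ ε := by
  have hlog : 0 < Real.log 2 := Real.log_pos one_lt_two
  set c : ℝ := 1 + 1 / (ε * Real.log 2) with hc
  set B : ℕ := ⌈(2 : ℝ) ^ (1 / ε)⌉₊ with hB
  have hc1 : 1 ≤ c := by rw [hc, le_add_iff_nonneg_right]; positivity
  refine ⟨c ^ B, by positivity, fun m hm => ?_⟩
  have local_bound : ∀ p ∈ m.primeFactors, ((m.factorization p + 1 : ℕ) : ℝ) ≤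
      (if p < B then c else 1) * ((p : ℝ) ^ m.factorization p) ^ ε := by
    intro p hp
    have hp2 : (2 : ℝ) ≤ p := by exact_mod_cast (Nat.prime_of_mem_primeFactors hp).two_le
    generalize m.factorization p = v
    rw [← Real.rpow_natCast_mul (by positivity), mul_comm (v : ℝ), Real.rpow_mul (by positivity),
      Real.rpow_natCast]
    split_ifs with hpB
    · have hexp : 1 + v * (ε * Real.log 2) ≤ ((p : ℝ) ^ ε) ^ v := by
        calc 1 + v * (ε * Real.log 2) ≤ Real.exp (v * (ε * Real.log 2)) := by
              linarith [Real.add_one_le_exp (v * (ε * Real.log 2))]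
          _ = ((2 : ℝ) ^ ε) ^ v := by
              rw [Real.exp_nat_mul, Real.rpow_def_of_pos two_pos, mul_comm ε]
          _ ≤ ((p : ℝ) ^ ε) ^ v := by gcongr
      have hmul : 1 / (ε * Real.log 2) * (v * (ε * Real.log 2)) = v := by field_simp
      have hpos : 0 ≤ v * (ε * Real.log 2) := by positivity
      have hpos' : 0 ≤ 1 / (ε * Real.log 2) := by positivity
      calc ((v + 1 : ℕ) : ℝ) ≤ c * (1 + v * (ε * Real.log 2)) := by
            push_cast; rw [hc]; linarith
        _ ≤ _ := by gcongr
    · have h2 : 2 ≤ (p : ℝ) ^ ε := by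
        have : (2 : ℝ) ^ (1 / ε) ≤ p := (Nat.le_ceil _).trans (by exact_mod_cast not_lt.1 hpB)
        calc (2 : ℝ) = ((2 : ℝ) ^ (1 / ε)) ^ ε := by
              rw [← Real.rpow_mul two_pos.le, one_div_mul_cancel hε.ne', Real.rpow_one]
          _ ≤ _ := by gcongr
      calc ((v + 1 : ℕ) : ℝ) ≤ (2 : ℝ) ^ v := by exact_mod_cast Nat.lt_two_pow_self (n := v)
        _ ≤ _ := by rw [one_mul]; gcongr
  have hprod : ∏ p ∈ m.primeFactors, ((p : ℝ) ^ m.factorization p) ^ ε = (m : ℝ) ^ ε := by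
    rw [Real.finsetProd_rpow _ _ (fun _ _ => by positivity)]
    congr 1
    exact_mod_cast Nat.prod_factorization_pow_eq_self hm
  rw [Nat.card_divisors hm, Nat.cast_prod]
  calc ∏ p ∈ m.primeFactors, ((m.factorization p + 1 : ℕ) : ℝ)
      ≤ ∏ p ∈ m.primeFactors, (if p < B then c else 1) * ((p : ℝ) ^ m.factorization p) ^ ε :=
        prod_le_prod (fun _ _ => by positivity) local_bound
    _ = (∏ p ∈ m.primeFactors, if p < B then c else 1) * (m : ℝ) ^ ε := by
        rw [prod_mul_distrib, hprod]
    _ ≤ c ^ B * (m : ℝ) ^ ε := by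
        gcongr
        rw [← prod_filter, prod_const]
        refine pow_le_pow_right₀ hc1 ?_
        calc #{p ∈ m.primeFactors | p < B} ≤ #(range B) :=
              card_le_card fun p hp => mem_range.2 (mem_filter.1 hp).2
          _ = B := card_range B

theorem sum_comp_le_sum_of_injOn {ι κ : Type*} [DecidableEq κ] {s : Finset ι} {t : Finset κ}
    {φ : ι → κ} {f : κ → ℝ} (hmaps : ∀ i ∈ s, φ i ∈ t) (hinj : Set.InjOn φ s)
    (hf : ∀ j ∈ t, 0 ≤ f j) : ∑ i ∈ s, f (φ i) ≤ ∑ j ∈ t, f j := by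
  rw [← sum_image (f := f) hinj]
  exact sum_le_sum_of_subset_of_nonneg (image_subset_iff.2 hmaps) fun j hj _ => hf j hj

namespace ZMod

variable {ℓ : ℕ}

theorem sum_sum_sub_le {G : ZMod ℓ → ℝ} (hG : ∀ x, 0 ≤ G x) (hneg : ∀ x, G (-x) = G x) (H : ℕ) :
    ∑ h ∈ range H, ∑ k ∈ range H, G ((h : ZMod ℓ) - k)
      ≤ H * (G 0 + 2 * ∑ k ∈ Ico 1 H, G k) := by
  have key : ∀ h ∈ range H, ∑ k ∈ range H, G ((h : ZMod ℓ) - k)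
      ≤ G 0 + 2 * ∑ k ∈ Ico 1 H, G k := by
    intro h hh
    have hH : 0 < H := (Nat.zero_le h).trans_lt (mem_range.1 hh)
    rw [← sum_filter_add_sum_filter_not (range H) (· ≤ h)]
    have hle : ∑ k ∈ range H with k ≤ h, G ((h : ZMod ℓ) - k) ≤ ∑ k ∈ range H, G k := by
      have hcast : ∀ k ∈ {k ∈ range H | k ≤ h}, G ((h : ZMod ℓ) - k) = G ((h - k : ℕ) : ZMod ℓ) :=
        fun k hk => by rw [Nat.cast_sub (mem_filter.1 hk).2]
      rw [sum_congr rfl hcast]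
      refine sum_comp_le_sum_of_injOn (f := fun k : ℕ => G k) (φ := fun k => h - k)
        (fun k _ => ?_) (fun k hk l hl hkl => ?_) fun _ _ => hG _
      · simp only [mem_range] at hh ⊢; omega
      · simp only [coe_filter, Set.mem_ofPred_eq] at hk hl hkl; omega
    have hgt : ∑ k ∈ range H with ¬ k ≤ h, G ((h : ZMod ℓ) - k) ≤ ∑ k ∈ Ico 1 H, G k := by
      have hcast : ∀ k ∈ {k ∈ range H | ¬ k ≤ h},
          G ((h : ZMod ℓ) - k) = G ((k - h : ℕ) : ZMod ℓ) := fun k hk => by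
        rw [Nat.cast_sub (not_le.1 (mem_filter.1 hk).2).le, ← hneg, neg_sub]
      rw [sum_congr rfl hcast]
      refine sum_comp_le_sum_of_injOn (f := fun k : ℕ => G k) (φ := fun k => k - h)
        (fun k hk => ?_) (fun k hk l hl hkl => ?_) fun _ _ => hG _
      · simp only [mem_filter, mem_range, mem_Ico] at hk ⊢; omega
      · simp only [coe_filter, Set.mem_ofPred_eq] at hk hl hkl; omega
    rw [range_eq_Ico, sum_eq_sum_Ico_succ_bot hH, Nat.cast_zero, zero_add] at hle
    rw [range_eq_Ico] at hgt ⊢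
    linarith
  calc _ ≤ ∑ h ∈ range H, (G 0 + 2 * ∑ k ∈ Ico 1 H, G k) := sum_le_sum key
    _ = _ := by rw [sum_const, card_range, nsmul_eq_mul]

/-- The solutions `(a, b, c, s, t)` of `a * s - b * t = c` with `1 ≤ a, b ≤ n`, `|c| ≤ n` and
`s, t ∈ S`. -/
noncomputable def bilinearSolutions (S : Finset (ZMod ℓ)) (n : ℕ) : Finset (ℕ × ℕ × ℤ × ZMod ℓ × ZMod ℓ) :=
  (Icc 1 n ×ˢ Icc 1 n ×ˢ Icc (-(n : ℤ)) (n : ℤ) ×ˢ S ×ˢ S).filter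
    fun x => (x.1 : ZMod ℓ) * x.2.2.2.1 - (x.2.1 : ZMod ℓ) * x.2.2.2.2 = ((x.2.2.1 : ℤ) : ZMod ℓ)

theorem mem_bilinearSolutions {S : Finset (ZMod ℓ)} {n a b : ℕ} {c : ℤ} {s t : ZMod ℓ} :
    (a, b, c, s, t) ∈ bilinearSolutions S n ↔
      (a ∈ Icc 1 n ∧ b ∈ Icc 1 n ∧ c ∈ Icc (-(n : ℤ)) n ∧ s ∈ S ∧ t ∈ S) ∧
        (a : ZMod ℓ) * s - (b : ZMod ℓ) * t = (c : ZMod ℓ) := by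
  simp only [bilinearSolutions, mem_filter, mem_product]

variable [NeZero ℓ]

theorem norm_sq_sum_stdAddChar {ι : Type*} (I : Finset ι) (f : ι → ZMod ℓ) :
    ((‖∑ i ∈ I, stdAddChar (f i)‖ ^ 2 : ℝ) : ℂ)
      = ∑ i ∈ I, ∑ j ∈ I, stdAddChar (f i - f j) := by
  push_cast
  rw [← Complex.mul_conj', map_sum, sum_mul_sum]
  simp_rw [← AddChar.map_neg_eq_conj, ← AddChar.map_add_eq_mul, ← sub_eq_add_neg]

theorem sum_norm_sq_sum_stdAddChar_mul (S : Finset (ZMod ℓ)) :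
    ∑ x : ZMod ℓ, ‖∑ s ∈ S, stdAddChar (x * s)‖ ^ 2 = (ℓ : ℝ) * #S := by
  apply Complex.ofReal_injective
  rw [Complex.ofReal_sum]
  simp_rw [norm_sq_sum_stdAddChar, ← mul_sub]
  rw [sum_comm]
  have key : ∀ s ∈ S, ∑ x : ZMod ℓ, ∑ t ∈ S, stdAddChar (x * (s - t)) = (ℓ : ℂ) := by
    intro s hs
    rw [sum_comm]
    simp_rw [AddChar.sum_mulShift _ (isPrimitive_stdAddChar ℓ), sub_eq_zero]
    simp [hs, ZMod.card]
  rw [sum_congr rfl key]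
  simp [mul_comm]

theorem sum_sum_norm_sq_sum_stdAddChar {ι κ : Type*} (I : Finset ι) (y : ι → ZMod ℓ)
    (A : Finset κ) (z : κ → ZMod ℓ) :
    ∑ i ∈ I, ∑ j ∈ I, ‖∑ h ∈ A, stdAddChar (z h * (y i - y j))‖ ^ 2
      = ∑ h ∈ A, ∑ k ∈ A, ‖∑ i ∈ I, stdAddChar ((z h - z k) * y i)‖ ^ 2 := by
  apply Complex.ofReal_injective
  simp_rw [Complex.ofReal_sum, norm_sq_sum_stdAddChar, ← sub_mul, ← mul_sub]
  simp_rw [sum_comm (s := I) (t := A)]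

theorem norm_sum_stdAddChar_neg_mul {ι : Type*} (I : Finset ι) (y : ι → ZMod ℓ) (x : ZMod ℓ) :
    ‖∑ i ∈ I, stdAddChar (-x * y i)‖ = ‖∑ i ∈ I, stdAddChar (x * y i)‖ := by
  simp_rw [neg_mul, AddChar.map_neg_eq_conj]
  rw [← map_sum, RCLike.norm_conj]

theorem half_le_norm_sum_range_stdAddChar {H n : ℕ} (hH : 6 * (H * n) ≤ ℓ) {c : ℤ}
    (hc : |c| ≤ n) :
    (H : ℝ) / 2 ≤ ‖∑ h ∈ range H, stdAddChar ((h : ZMod ℓ) * (c : ZMod ℓ))‖ := by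
  have hℓ : (0 : ℝ) < ℓ := by exact_mod_cast NeZero.pos ℓ
  refine le_trans ?_ (Complex.re_le_norm _)
  rw [Complex.re_sum]
  have key : ∀ h ∈ range H,
      (1 / 2 : ℝ) ≤ (stdAddChar ((h : ZMod ℓ) * (c : ZMod ℓ))).re := by
    intro h hh
    have hcast : (h : ZMod ℓ) * (c : ZMod ℓ) = ((h * c : ℤ) : ZMod ℓ) := by push_cast; rfl
    have hre : (2 * π * Complex.I * ((h * c : ℤ) : ℂ) / ℓ)
        = ((2 * π * (h * c) / ℓ : ℝ) : ℂ) * Complex.I := by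
      push_cast; ring
    rw [hcast, stdAddChar_coe, hre, Complex.exp_ofReal_mul_I_re, ← Real.cos_abs,
      ← Real.cos_pi_div_three]
    have hcR : |(c : ℝ)| ≤ n := by exact_mod_cast hc
    have hhR : (h : ℝ) ≤ H := by exact_mod_cast (mem_range.1 hh).le
    have hHR : 6 * ((H : ℝ) * n) ≤ ℓ := by exact_mod_cast hH
    have hprod : (h : ℝ) * |(c : ℝ)| ≤ H * n := by gcongr
    refine Real.cos_le_cos_of_nonneg_of_le_pi (abs_nonneg _) (by linarith [Real.pi_pos]) ?_
    rw [abs_div, abs_mul, abs_mul (h : ℝ), abs_of_pos hℓ, abs_of_pos Real.two_pi_pos, Nat.abs_cast,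
      div_le_iff₀ hℓ]
    nlinarith [Real.pi_pos]
  calc (H : ℝ) / 2 = ∑ h ∈ range H, (1 / 2 : ℝ) := by simp [div_eq_mul_inv]
    _ ≤ _ := sum_le_sum key

/-- The residues `k * a` with `k < H`, `a ≤ n` have multiplicity at most the maximal number of
divisors of a positive integer below `ℓ`. -/
theorem sum_sum_comp_mul_le {H n : ℕ} (hH : H * n ≤ ℓ) {D : ℝ} (hD0 : 0 ≤ D)
    (hD : ∀ m : ℕ, 0 < m → m < ℓ → (#m.divisors : ℝ) ≤ D) {F : ZMod ℓ → ℝ} (hF : ∀ x, 0 ≤ F x) :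
    ∑ k ∈ Ico 1 H, ∑ a ∈ Icc 1 n, F ((k : ZMod ℓ) * (a : ZMod ℓ)) ≤ D * ∑ x, F x := by
  rw [← sum_product' (Ico 1 H) (Icc 1 n) fun k a => F ((k : ZMod ℓ) * (a : ZMod ℓ)),
    sum_comp F fun p : ℕ × ℕ => (p.1 : ZMod ℓ) * (p.2 : ZMod ℓ), mul_sum]
  have hval : ∀ p ∈ Ico 1 H ×ˢ Icc 1 n, 0 < p.1 * p.2 ∧ p.1 * p.2 < ℓ ∧
      ((p.1 : ZMod ℓ) * (p.2 : ZMod ℓ)).val = p.1 * p.2 := by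
    rintro ⟨k, a⟩ hp
    simp only [mem_product, mem_Ico, mem_Icc] at hp
    have hlt : k * a < ℓ := by nlinarith [hp.1.2, hp.2.2, hp.2.1]
    exact ⟨Nat.mul_pos hp.1.1 hp.2.1, hlt, by rw [← Nat.cast_mul, val_natCast_of_lt hlt]⟩
  have fiber : ∀ x ∈ (Ico 1 H ×ˢ Icc 1 n).image
      (fun p : ℕ × ℕ => (p.1 : ZMod ℓ) * (p.2 : ZMod ℓ)),
      (#{p ∈ Ico 1 H ×ˢ Icc 1 n | (p.1 : ZMod ℓ) * (p.2 : ZMod ℓ) = x} : ℝ) ≤ D := by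
    intro x hx
    have hx0 : 0 < x.val ∧ x.val < ℓ := by
      obtain ⟨p, hp, rfl⟩ := mem_image.1 hx
      obtain ⟨h1, h2, h3⟩ := hval p hp
      rw [h3]; exact ⟨h1, h2⟩
    refine le_trans ?_ (hD x.val hx0.1 hx0.2)
    have hmem : ∀ p ∈ ({p ∈ Ico 1 H ×ˢ Icc 1 n | (p.1 : ZMod ℓ) * (p.2 : ZMod ℓ) = x} :
        Finset (ℕ × ℕ)), p.1 * p.2 = x.val := fun p hp => by
      rw [mem_filter] at hp
      rw [← hp.2, (hval p hp.1).2.2]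
    refine Nat.cast_le.2 (card_le_card_of_injOn Prod.fst (fun p hp => ?_) fun p hp q hq hpq => ?_)
    · exact Nat.mem_divisors.2 ⟨⟨p.2, (hmem p hp).symm⟩, hx0.1.ne'⟩
    · have h := (hmem p hp).trans (hmem q hq).symm
      have hp1 : 0 < p.1 := by
        have := hx0.1; rw [← hmem p hp] at this; exact Nat.pos_of_mul_pos_right this
      rw [← hpq] at h
      exact Prod.ext hpq (Nat.eq_of_mul_eq_mul_left hp1 h)
  calc _ ≤ ∑ x ∈ (Ico 1 H ×ˢ Icc 1 n).image
          (fun p : ℕ × ℕ => (p.1 : ZMod ℓ) * (p.2 : ZMod ℓ)), D * F x :=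
        sum_le_sum fun x hx => by
          rw [nsmul_eq_mul]
          exact mul_le_mul_of_nonneg_right (fiber x hx) (hF x)
    _ ≤ _ := sum_le_sum_of_subset_of_nonneg (subset_univ _)
        fun x _ _ => mul_nonneg hD0 (hF x)

theorem sum_norm_sq_sum_product_le {H n : ℕ} (hH : H * n ≤ ℓ) {D : ℝ} (hD0 : 0 ≤ D)
    (hD : ∀ m : ℕ, 0 < m → m < ℓ → (#m.divisors : ℝ) ≤ D) (S : Finset (ZMod ℓ)) :
    ∑ k ∈ Ico 1 H, ‖∑ p ∈ Icc 1 n ×ˢ S, stdAddChar ((k : ZMod ℓ) * ((p.1 : ZMod ℓ) * p.2))‖ ^ 2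
      ≤ n * (D * (ℓ * #S)) := by
  have key : ∀ k ∈ Ico 1 H,
      ‖∑ p ∈ Icc 1 n ×ˢ S, stdAddChar ((k : ZMod ℓ) * ((p.1 : ZMod ℓ) * p.2))‖ ^ 2
        ≤ n * ∑ a ∈ Icc 1 n, ‖∑ s ∈ S, stdAddChar ((k : ZMod ℓ) * (a : ZMod ℓ) * s)‖ ^ 2 := by
    intro k _
    rw [sum_product]
    simp_rw [← mul_assoc]
    refine (pow_le_pow_left₀ (norm_nonneg _) (norm_sum_le _ _) 2).trans ?_
    refine sq_sum_le_card_mul_sum_sq.trans_eq ?_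
    rw [Nat.card_Icc, Nat.add_sub_cancel]
  refine (sum_le_sum key).trans ?_
  rw [← mul_sum, ← sum_norm_sq_sum_stdAddChar_mul S]
  gcongr
  exact sum_sum_comp_mul_le hH hD0 hD (F := fun x => ‖∑ s ∈ S, stdAddChar (x * s)‖ ^ 2)
    fun _ => by positivity

theorem card_bilinearSolutions_le_of_lt {S : Finset (ZMod ℓ)} {n : ℕ} (hn : ℓ < 6 * n) :
    (#(bilinearSolutions S n) : ℝ) ≤ 8 * ((ℓ : ℝ)⁻¹ * (n : ℝ) ^ 3 * (#S : ℝ) ^ 2) := by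
  have hℓ : 0 < ℓ := NeZero.pos ℓ
  have hℓR : (0 : ℝ) < ℓ := by exact_mod_cast hℓ
  have hnR : (ℓ : ℝ) ≤ 6 * n := by exact_mod_cast hn.le
  set q : ℕ := 2 * n / ℓ + 1 with hq
  have hfiber : ∀ p ∈ Icc 1 n ×ˢ Icc 1 n ×ˢ S ×ˢ S,
      #{x ∈ bilinearSolutions S n | (x.1, x.2.1, x.2.2.2) = p} ≤ q := by
    rintro ⟨a, b, s, t⟩ -
    have hinj : #{x ∈ bilinearSolutions S n | (x.1, x.2.1, x.2.2.2) = (a, b, s, t)}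
        ≤ #(range q) := by
      refine card_le_card_of_injOn (fun x => ((x.2.2.1 + n) / ℓ).toNat) ?_ ?_
      · rintro ⟨a', b', c, s', t'⟩ hx
        simp only [coe_filter, mem_bilinearSolutions, Set.mem_ofPred_eq, mem_Icc] at hx
        obtain ⟨⟨⟨-, -, hc, -⟩, -⟩, -⟩ := hx
        have h1 : (c + n) / (ℓ : ℤ) ≤ (2 * n : ℕ) / (ℓ : ℤ) :=
          Int.ediv_le_ediv (by exact_mod_cast hℓ) (by push_cast; omega)
        have h2 : (((2 * n / ℓ : ℕ) : ℤ)) = (2 * n : ℕ) / (ℓ : ℤ) := Int.natCast_div _ _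
        have h3 : (q : ℤ) = (2 * n : ℕ) / (ℓ : ℤ) + 1 := by rw [hq, Nat.cast_succ, h2]
        have h4 : 0 < q := Nat.succ_pos _
        simp only [coe_range, Set.mem_Iio]
        omega
      · rintro ⟨a', b', c, s', t'⟩ hx ⟨a₂, b₂, d, s₂, t₂⟩ hy hxy
        simp only [coe_filter, mem_bilinearSolutions, Set.mem_ofPred_eq, mem_Icc,
          Prod.mk.injEq] at hx hy hxy
        obtain ⟨⟨⟨-, -, hc, -⟩, hx⟩, rfl, rfl, rfl, rfl⟩ := hx
        obtain ⟨⟨⟨-, -, hd, -⟩, hy⟩, rfl, rfl, rfl, rfl⟩ := hy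
        have hmod : (c + n) % (ℓ : ℤ) = (d + n) % (ℓ : ℤ) :=
          ((ZMod.intCast_eq_intCast_iff c d ℓ).1 (hx.symm.trans hy)).add_right _
        have h1 : 0 ≤ (c + n) / (ℓ : ℤ) := Int.ediv_nonneg (by omega) (by omega)
        have h2 : 0 ≤ (d + n) / (ℓ : ℤ) := Int.ediv_nonneg (by omega) (by omega)
        have hdiv : (c + n) / (ℓ : ℤ) = (d + n) / (ℓ : ℤ) := by omega
        have hcd : c + n = d + n := by
          rw [← Int.mul_ediv_add_emod (c + n) ℓ, ← Int.mul_ediv_add_emod (d + n) ℓ, hdiv, hmod]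
        simp only [Prod.mk.injEq, true_and, and_true]
        omega
    rwa [card_range] at hinj
  have hmaps : ∀ x ∈ bilinearSolutions S n,
      (x.1, x.2.1, x.2.2.2) ∈ Icc 1 n ×ˢ Icc 1 n ×ˢ S ×ˢ S := by
    rintro ⟨a, b, c, s, t⟩ hx
    obtain ⟨⟨ha, hb, -, hs, ht⟩, -⟩ := mem_bilinearSolutions.1 hx
    simp only [mem_product]
    exact ⟨ha, hb, hs, ht⟩
  have hcard := card_le_mul_card_image_of_maps_to hmaps q hfiber
  simp only [card_product, Nat.card_Icc, Nat.add_sub_cancel] at hcard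
  have hqR : (q : ℝ) ≤ 8 * n / ℓ := by
    have : ((2 * n / ℓ : ℕ) : ℝ) ≤ (2 * n : ℕ) / (ℓ : ℝ) := Nat.cast_div_le
    rw [hq, le_div_iff₀ hℓR]
    rw [le_div_iff₀ hℓR] at this
    push_cast at this ⊢
    linarith
  calc (#(bilinearSolutions S n) : ℝ) ≤ q * (n * (n * (#S * #S))) := by exact_mod_cast hcard
    _ ≤ 8 * n / ℓ * (n * (n * (#S * #S))) := by gcongr
    _ = _ := by field_simp

theorem card_bilinearSolutions_le_of_le {S : Finset (ZMod ℓ)} {n : ℕ} (hn0 : 0 < n)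
    (hn : 6 * n ≤ ℓ) {D : ℝ} (hD0 : 0 ≤ D)
    (hD : ∀ m : ℕ, 0 < m → m < ℓ → (#m.divisors : ℝ) ≤ D) :
    (#(bilinearSolutions S n) : ℝ)
      ≤ 48 * ((ℓ : ℝ)⁻¹ * (n : ℝ) ^ 3 * (#S : ℝ) ^ 2) + 96 * (D * (n : ℝ) ^ 2 * #S) := by
  have hℓR : (0 : ℝ) < ℓ := by exact_mod_cast NeZero.pos ℓ
  have hnR : (0 : ℝ) < n := by exact_mod_cast hn0
  set H : ℕ := ℓ / (6 * n) with hH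
  have hH1 : 1 ≤ H := (Nat.one_le_div_iff (by omega)).2 hn
  have hHn : 6 * (H * n) ≤ ℓ := by
    have := Nat.div_mul_le_self ℓ (6 * n)
    rw [← hH] at this; linarith
  have hHR : (1 : ℝ) ≤ H := by exact_mod_cast hH1
  have hHlow : (ℓ : ℝ) ≤ 12 * n * H := by
    have h1 : ℓ < 6 * n * (H + 1) := Nat.lt_mul_div_succ ℓ (by omega)
    have h2 : (ℓ : ℝ) ≤ 6 * n * (H + 1) := by exact_mod_cast h1.le
    nlinarith
  set I := Icc 1 n ×ˢ S with hI
  set y : ℕ × ZMod ℓ → ZMod ℓ := fun p => (p.1 : ZMod ℓ) * p.2 with hy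
  set G : ZMod ℓ → ℝ := fun x => ‖∑ p ∈ I, stdAddChar (x * y p)‖ ^ 2 with hG
  set F : (ℕ × ZMod ℓ) × (ℕ × ZMod ℓ) → ℝ :=
    fun r => ‖∑ h ∈ range H, stdAddChar ((h : ZMod ℓ) * (y r.1 - y r.2))‖ ^ 2 with hF
  let φ : ℕ × ℕ × ℤ × ZMod ℓ × ZMod ℓ → (ℕ × ZMod ℓ) × (ℕ × ZMod ℓ) :=
    fun x => ((x.1, x.2.2.2.1), (x.2.1, x.2.2.2.2))
  have hlower : ∀ x ∈ bilinearSolutions S n, ((H : ℝ) / 2) ^ 2 ≤ F (φ x) := by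
    rintro ⟨a, b, c, s, t⟩ hx
    obtain ⟨⟨-, -, hc, -, -⟩, h⟩ := mem_bilinearSolutions.1 hx
    have := half_le_norm_sum_range_stdAddChar hHn (abs_le.2 (mem_Icc.1 hc))
    simp only [hF, φ, hy, h]
    gcongr
  have hsum : ∑ x ∈ bilinearSolutions S n, F (φ x) ≤ ∑ r ∈ I ×ˢ I, F r := by
    refine sum_comp_le_sum_of_injOn ?_ ?_ fun r _ => by positivity
    · rintro ⟨a, b, c, s, t⟩ hx
      obtain ⟨⟨ha, hb, -, hs, ht⟩, -⟩ := mem_bilinearSolutions.1 hx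
      simp only [φ, hI, mem_product]
      exact ⟨⟨ha, hs⟩, hb, ht⟩
    · rintro ⟨a, b, c, s, t⟩ hx ⟨a', b', d, s', t'⟩ hx' h
      simp only [φ, Prod.mk.injEq] at h
      obtain ⟨⟨rfl, rfl⟩, rfl, rfl⟩ := h
      obtain ⟨⟨-, -, hc, -, -⟩, hx⟩ := mem_bilinearSolutions.1 hx
      obtain ⟨⟨-, -, hd, -, -⟩, hx'⟩ := mem_bilinearSolutions.1 hx'
      have hdvd : (ℓ : ℤ) ∣ d - c :=
        (ZMod.intCast_eq_intCast_iff_dvd_sub c d ℓ).1 (hx.symm.trans hx')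
      rw [mem_Icc] at hc hd
      have : d - c = 0 := Int.eq_zero_of_abs_lt_dvd hdvd (by rw [abs_lt]; omega)
      obtain rfl : c = d := by omega
      rfl
  have hG0 : G 0 = ((n : ℝ) * #S) ^ 2 := by
    simp [hG, hI]
  have hupper : ∑ r ∈ I ×ˢ I, F r ≤ H * (((n : ℝ) * #S) ^ 2 + 2 * (n * (D * (ℓ * #S)))) := by
    rw [sum_product]
    simp only [hF]
    rw [sum_sum_norm_sq_sum_stdAddChar I y (range H) fun h => (h : ZMod ℓ)]
    refine (sum_sum_sub_le (G := G) (fun x => by positivity)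
      (fun x => by simp only [hG, norm_sum_stdAddChar_neg_mul]) H).trans ?_
    rw [hG0]
    gcongr
    exact sum_norm_sq_sum_product_le (by omega) hD0 hD S
  have hmain : #(bilinearSolutions S n) * ((H : ℝ) / 2) ^ 2
      ≤ H * (((n : ℝ) * #S) ^ 2 + 2 * (n * (D * (ℓ * #S)))) := by
    rw [← nsmul_eq_mul]
    exact (card_nsmul_le_sum _ _ _ hlower).trans (hsum.trans hupper)
  set N : ℝ := (#(bilinearSolutions S n) : ℝ)
  set E : ℝ := ((n : ℝ) * #S) ^ 2 + 2 * (n * (D * (ℓ * #S))) with hE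
  have hE0 : 0 ≤ E := by positivity
  have hN : N * H ≤ 4 * E := by nlinarith
  have hNℓ : N * ℓ ≤ 48 * n * E := by
    calc N * ℓ ≤ N * (12 * n * H) := by gcongr
      _ = 12 * n * (N * H) := by ring
      _ ≤ 12 * n * (4 * E) := by gcongr
      _ = _ := by ring
  calc N ≤ 48 * n * E / ℓ := (le_div_iff₀ hℓR).2 hNℓ
    _ = _ := by rw [hE]; field_simp; ring

end ZMod


/-- For a prime `ℓ`, `S ⊆ F_ℓ` and a positive integer `n`, the number `N(ℓ, S, n)` of
solutions to `a·s - b·t ≡ c (mod ℓ)` with `1 ≤ a, b ≤ n`, `|c| ≤ n`, `s, t ∈ S` satisfies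
`N(ℓ, S, n) ≤ C(ε) (ℓ^{-1} n³ |S|² + ℓ^ε n² |S|)`. -/
theorem stmt_4 (ε : ℝ) (hε : 0 < ε) :
    ∃ C : ℝ, ∀ (ℓ : ℕ), ℓ.Prime → ∀ (S : Finset (ZMod ℓ)) (n : ℕ), 0 < n →
      (((Finset.Icc 1 n ×ˢ Finset.Icc 1 n ×ˢ Finset.Icc (-(n : ℤ)) (n : ℤ) ×ˢ S ×ˢ S).filter
          (fun x : ℕ × ℕ × ℤ × ZMod ℓ × ZMod ℓ =>
            (x.1 : ZMod ℓ) * x.2.2.2.1 - (x.2.1 : ZMod ℓ) * x.2.2.2.2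
              = ((x.2.2.1 : ℤ) : ZMod ℓ))).card : ℝ)
        ≤ C * ((ℓ : ℝ)⁻¹ * (n : ℝ) ^ 3 * (S.card : ℝ) ^ 2
            + (ℓ : ℝ) ^ ε * (n : ℝ) ^ 2 * (S.card : ℝ)) := by
  obtain ⟨C, hC0, hC⟩ := exists_card_divisors_le_rpow ε hε
  refine ⟨48 + 96 * C, fun ℓ hℓ S n hn => ?_⟩
  have : NeZero ℓ := ⟨hℓ.ne_zero⟩
  change (#(ZMod.bilinearSolutions S n) : ℝ) ≤ _
  set X : ℝ := (ℓ : ℝ)⁻¹ * (n : ℝ) ^ 3 * (#S : ℝ) ^ 2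
  set Y : ℝ := (ℓ : ℝ) ^ ε * (n : ℝ) ^ 2 * (#S : ℝ)
  have hX : 0 ≤ X := by positivity
  have hY : 0 ≤ Y := by positivity
  have hCX : 0 ≤ C * X := by positivity
  have hCY : 0 ≤ C * Y := by positivity
  rcases lt_or_ge ℓ (6 * n) with hlt | hle
  · have := ZMod.card_bilinearSolutions_le_of_lt (S := S) hlt
    linarith
  · have := ZMod.card_bilinearSolutions_le_of_le (S := S) hn hle (D := C * (ℓ : ℝ) ^ ε)
      (by positivity) fun m hm hmℓ => (hC m hm.ne').trans (by gcongr)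
    have hYC : C * (ℓ : ℝ) ^ ε * (n : ℝ) ^ 2 * #S = C * Y := by simp only [Y]; ring
    rw [hYC] at this
    linarith
end

section
/- Let q ≥ 3 be a positive integer, χ a primitive Dirichlet character mod q, and H ≤ q a positive integer. Let 0 ≤ N_1 < N_2 < ⋯ < N_J < q be integers satisfying N_{j+1} − N_j ≥ H for all 1 ≤ j < J. Then there is an absolute constant C such that ∑_{j=1}^{J} max_{1 ≤ h ≤ H} |S(N_j; h)|^2 ≤ C · q (log q)^2. -/
open ZMod in
/-- The Parseval identity for the discrete Fourier transform. -/
theorem ZMod.sum_norm_dft_sq {q : ℕ} [NeZero q] (f : ZMod q → ℂ) :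
    ∑ k, ‖𝓕 f k‖ ^ 2 = q * ∑ x, ‖f x‖ ^ 2 := by
  have key : ∑ k, 𝓕 f k * (starRingEnd ℂ) (𝓕 f k) = q * ∑ x, f x * (starRingEnd ℂ) (f x) := by
    simp only [dft_apply, map_sum, smul_eq_mul, map_mul, ← AddChar.map_neg_eq_conj, neg_neg,
      Finset.sum_mul_sum]
    rw [Finset.sum_comm, Finset.mul_sum]
    refine Finset.sum_congr rfl fun x _ => ?_
    rw [Finset.sum_comm]
    have (y k : ZMod q) : stdAddChar (-(x * k)) * f x *
        (stdAddChar (y * k) * (starRingEnd ℂ) (f y)) =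
        stdAddChar (k * (y - x)) * (f x * (starRingEnd ℂ) (f y)) := by
      rw [show k * (y - x) = -(x * k) + y * k by ring, AddChar.map_add_eq_mul]
      ring
    simp only [this, ← Finset.sum_mul, AddChar.sum_mulShift _ (isPrimitive_stdAddChar q),
      sub_eq_zero, ZMod.card]
    rw [Finset.sum_eq_single x] <;> simp +contextual
  simp only [Complex.mul_conj, Complex.normSq_eq_norm_sq] at key
  exact_mod_cast key

open ZMod in
/-- The Fourier transform of a translate. -/
theorem ZMod.dft_translate_sub {q : ℕ} [NeZero q] (f : ZMod q → ℂ) (L k : ZMod q) :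
    𝓕 (fun x => f (x + L) - f x) k = (stdAddChar (L * k) - 1) * 𝓕 f k := by
  simp only [dft_apply, smul_eq_mul, mul_sub, Finset.sum_sub_distrib, sub_mul, one_mul]
  congr 1
  rw [Finset.mul_sum]
  refine Fintype.sum_equiv (Equiv.addRight L) _ _ fun x => ?_
  rw [Equiv.coe_addRight, ← mul_assoc, ← AddChar.map_add_eq_mul]
  congr 2
  ring

theorem DirichletCharacter.norm_inv_apply {q : ℕ} (χ : DirichletCharacter ℂ q)
    (a : ZMod q) : ‖χ⁻¹ a‖ = ‖χ a‖ := by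
  by_cases h : IsUnit a
  · obtain ⟨u, rfl⟩ := h
    rw [DirichletCharacter.unit_norm_eq_one, DirichletCharacter.unit_norm_eq_one]
  · rw [MulChar.map_nonunit _ h, MulChar.map_nonunit _ h]

open ZMod in
theorem DirichletCharacter.IsPrimitive.norm_gaussSum_sq {q : ℕ} [NeZero q]
    {χ : DirichletCharacter ℂ q} (hχ : χ.IsPrimitive) :
    ‖gaussSum χ stdAddChar‖ ^ 2 = q := by
  have h := ZMod.sum_norm_dft_sq (χ : ZMod q → ℂ)
  simp only [hχ.fourierTransform_eq_inv_mul_gaussSum, norm_mul, mul_pow,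
    DirichletCharacter.norm_inv_apply, ← Finset.sum_mul] at h
  have hneg : ∑ x, ‖χ (-x)‖ ^ 2 = ∑ x, ‖χ x‖ ^ 2 :=
    Equiv.sum_comp (Equiv.neg (ZMod q)) (fun x => ‖χ x‖ ^ 2)
  rw [hneg] at h
  refine mul_left_cancel₀ (ne_of_gt ?_) (h.trans (mul_comm _ _))
  refine Finset.sum_pos' (fun _ _ => by positivity) ⟨1, Finset.mem_univ _, by simp⟩

open ZMod in
theorem DirichletCharacter.IsPrimitive.norm_dft_sq_le {q : ℕ} [NeZero q]
    {χ : DirichletCharacter ℂ q} (hχ : χ.IsPrimitive) (k : ZMod q) :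
    ‖𝓕 (χ : ZMod q → ℂ) k‖ ^ 2 ≤ q := by
  rw [hχ.fourierTransform_eq_inv_mul_gaussSum, norm_mul, mul_pow, hχ.norm_gaussSum_sq]
  have := DirichletCharacter.norm_le_one χ⁻¹ (-k)
  exact mul_le_of_le_one_left (by positivity) (pow_le_one₀ (norm_nonneg _) this)

/-- The identity `∑ sin²(π a L / q) / sin²(π L / q) = a (q - a)`, in exponential form. -/
theorem ZMod.sum_norm_stdAddChar_sub_one_sq_div {q : ℕ} [NeZero q] (a : ZMod q) :
    ∑ L ∈ Finset.univ.erase 0, ‖stdAddChar (L * a) - 1‖ ^ 2 / ‖stdAddChar L - 1‖ ^ 2 =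
      a.val * (q - a.val : ℝ) := by
  set f : ZMod q → ℂ := fun x => if x.val < a.val then 1 else 0 with hf
  have hsum : ∀ g : ZMod q → ℂ, ∑ x, g x * f x = ∑ m ∈ Finset.range a.val, g m := by
    intro g
    simp only [hf, mul_ite, mul_one, mul_zero, ← Finset.sum_filter]
    symm
    refine Finset.sum_bij' (fun m _ => (m : ZMod q)) (fun x _ => x.val) ?_ ?_ ?_ ?_ ?_
    · intro m hm
      have := Finset.mem_range.mp hm
      simp [ZMod.val_cast_of_lt (this.trans a.val_lt), this]
    · intro x hx
      simpa using hx
    · intro m hm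
      exact ZMod.val_cast_of_lt ((Finset.mem_range.mp hm).trans a.val_lt)
    · intro x _
      simp
    · intro m _
      rfl
  have hdft (L : ZMod q) : ZMod.dft f (-L) = ∑ m ∈ Finset.range a.val, stdAddChar L ^ m := by
    rw [dft_apply]
    simp only [smul_eq_mul]
    rw [hsum]
    refine Finset.sum_congr rfl fun m _ => ?_
    rw [← AddChar.map_nsmul_eq_pow, nsmul_eq_mul, mul_neg, neg_neg]
  have hterm (L : ZMod q) (hL : L ∈ Finset.univ.erase 0) :
      ‖stdAddChar (L * a) - 1‖ ^ 2 / ‖stdAddChar L - 1‖ ^ 2 = ‖ZMod.dft f (-L)‖ ^ 2 := by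
    have hne : (stdAddChar L : ℂ) ≠ 1 := fun h => (Finset.ne_of_mem_erase hL)
      (injective_stdAddChar (h.trans (AddChar.map_zero_eq_one _).symm))
    rw [hdft, geom_sum_eq hne, norm_div, div_pow, ← AddChar.map_nsmul_eq_pow, nsmul_eq_mul,
      ZMod.natCast_zmod_val, mul_comm]
  have hneg : ∑ L, ‖ZMod.dft f (-L)‖ ^ 2 = ∑ L, ‖ZMod.dft f L‖ ^ 2 :=
    Equiv.sum_comp (Equiv.neg (ZMod q)) (fun x => ‖ZMod.dft f x‖ ^ 2)
  rw [Finset.sum_congr rfl hterm, Finset.sum_erase_eq_sub (Finset.mem_univ _), hneg,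
    sum_norm_dft_sq, hdft]
  have h2 : ∑ x, ‖f x‖ ^ 2 = a.val := by
    have := hsum 1
    simp only [Pi.one_apply, one_mul, Finset.sum_const, Finset.card_range, nsmul_eq_mul,
      mul_one] at this
    have h3 (x) : ((‖f x‖ ^ 2 : ℝ) : ℂ) = f x := by
      simp only [hf]; split_ifs <;> simp
    rw [← Complex.ofReal_inj, Complex.ofReal_sum]
    simp only [h3, this, Complex.ofReal_natCast]
  rw [h2]
  simp only [AddChar.map_zero_eq_one, one_pow, Finset.sum_const, Finset.card_range, nsmul_eq_mul,
    mul_one, Complex.norm_natCast]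
  ring

theorem ZMod.sum_erase_zero_eq_sum_Ico {q : ℕ} [NeZero q] (g : ℕ → ℝ) :
    ∑ x ∈ (Finset.univ : Finset (ZMod q)).erase 0, g x.val = ∑ n ∈ Finset.Ico 1 q, g n := by
  refine Finset.sum_bij' (fun x _ => x.val) (fun m _ => (m : ZMod q)) ?_ ?_ ?_ ?_ ?_
  · intro x hx
    have h0 : x.val ≠ 0 := by simpa [ZMod.val_eq_zero] using hx
    exact Finset.mem_Ico.mpr ⟨Nat.one_le_iff_ne_zero.mpr h0, x.val_lt⟩
  · intro m hm
    obtain ⟨h1, h2⟩ := Finset.mem_Ico.mp hm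
    rw [Finset.mem_erase, ← ZMod.val_ne_zero, ZMod.val_cast_of_lt h2]
    exact ⟨by lia, Finset.mem_univ _⟩
  · intro x _
    simp
  · intro m hm
    exact ZMod.val_cast_of_lt (Finset.mem_Ico.mp hm).2
  · intro x _
    rfl

theorem sum_Ico_inv_add_inv_sub (q : ℕ) :
    ∑ n ∈ Finset.Ico 1 q, ((n : ℝ)⁻¹ + (q - n : ℝ)⁻¹) = 2 * ∑ n ∈ Finset.Ico 1 q, (n : ℝ)⁻¹ := by
  rw [Finset.sum_add_distrib, two_mul]
  congr 1
  refine Finset.sum_bij' (fun n _ => q - n) (fun n _ => q - n) ?_ ?_ ?_ ?_ ?_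
  · intro n hn; simp only [Finset.mem_Ico] at *; lia
  · intro n hn; simp only [Finset.mem_Ico] at *; lia
  · intro n hn; simp only [Finset.mem_Ico] at *; lia
  · intro n hn; simp only [Finset.mem_Ico] at *; lia
  · intro n hn
    rw [Nat.cast_sub (Finset.mem_Ico.mp hn).2.le]

theorem sum_Ico_inv_le_two_mul_log {q : ℕ} (hq : 3 ≤ q) :
    ∑ n ∈ Finset.Ico 1 q, (n : ℝ)⁻¹ ≤ 2 * Real.log q := by
  have h1 := harmonic_le_one_add_log q
  rw [harmonic_eq_sum_Icc] at h1
  push_cast at h1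
  have h2 : ∑ n ∈ Finset.Ico 1 q, (n : ℝ)⁻¹ ≤ ∑ n ∈ Finset.Icc 1 q, (n : ℝ)⁻¹ :=
    Finset.sum_le_sum_of_subset_of_nonneg Finset.Ico_subset_Icc_self
      fun _ _ _ => by positivity
  have h3 : 1 ≤ Real.log q := by
    rw [Real.le_log_iff_exp_le (by positivity)]
    have : (3 : ℝ) ≤ q := by exact_mod_cast hq
    linarith [Real.exp_one_lt_d9]
  linarith

theorem ZMod.four_mul_min_div_le_norm_stdAddChar_sub_one {q : ℕ} [NeZero q] (L : ZMod q) :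
    4 * min (L.val : ℝ) (q - L.val) / q ≤ ‖stdAddChar L - 1‖ := by
  have hq : (0 : ℝ) < q := by exact_mod_cast NeZero.pos q
  have hL : (L.val : ℝ) < q := by exact_mod_cast L.val_lt
  have h1 : (stdAddChar L : ℂ) =
      Complex.exp (Complex.I * ((2 * Real.pi * L.val / q : ℝ) : ℂ)) := by
    conv_lhs => rw [← ZMod.natCast_zmod_val L, ← Int.cast_natCast, stdAddChar_coe]
    congr 1
    push_cast
    ring
  rw [h1, Complex.norm_exp_I_mul_ofReal_sub_one]
  have hπ := Real.pi_pos
  set t : ℝ := L.val / q with ht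
  have ht0 : 0 ≤ t := by positivity
  have ht1 : t < 1 := (div_lt_one hq).mpr hL
  have e1 : 2 * Real.pi * L.val / q / 2 = Real.pi * t := by rw [ht]; ring
  have e2 : 4 * min (L.val : ℝ) (q - L.val) / q = 4 * min t (1 - t) := by
    rw [mul_div_assoc, ← min_div_div_right hq.le, sub_div, div_self hq.ne']
  rw [e1, e2]
  have h3 : 2 * min t (1 - t) ≤ Real.sin (Real.pi * t) := by
    rcases le_total t (1 / 2) with h | h
    · rw [min_eq_left (by linarith)]
      have := Real.mul_le_sin (x := Real.pi * t) (by positivity) (by nlinarith)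
      rwa [show 2 / Real.pi * (Real.pi * t) = 2 * t by field_simp] at this
    · rw [min_eq_right (by linarith)]
      have := Real.mul_le_sin (x := Real.pi * (1 - t)) (by nlinarith) (by nlinarith)
      rwa [show 2 / Real.pi * (Real.pi * (1 - t)) = 2 * (1 - t) by field_simp,
        show Real.pi * (1 - t) = Real.pi - Real.pi * t by ring, Real.sin_pi_sub] at this
  calc 4 * min t (1 - t) ≤ 2 * Real.sin (Real.pi * t) := by linarith
    _ ≤ ‖2 * Real.sin (Real.pi * t)‖ := Real.le_norm_self _

/-- The fractional Sobolev energy `∑_{L ≠ 0} ∑_x |F(x + L) - F(x)|² / |e(L / q) - 1|²` of a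
function on `ZMod q`. -/
noncomputable def ZMod.energy {q : ℕ} [NeZero q] (F : ZMod q → ℂ) : ℝ :=
  ∑ L ∈ Finset.univ.erase 0, (∑ x, ‖F (x + L) - F x‖ ^ 2) / ‖stdAddChar L - 1‖ ^ 2

theorem ZMod.sum_norm_dft_sq_mul_eq_energy {q : ℕ} [NeZero q] (F : ZMod q → ℂ) :
    ∑ k, ‖ZMod.dft F k‖ ^ 2 * (k.val * (q - k.val : ℝ)) = q * ZMod.energy F := by
  simp only [← sum_norm_stdAddChar_sub_one_sq_div, Finset.mul_sum]
  rw [Finset.sum_comm, energy, Finset.mul_sum]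
  refine Finset.sum_congr rfl fun L _ => ?_
  rw [← mul_div_assoc, ← sum_norm_dft_sq, Finset.sum_div]
  simp only [dft_translate_sub, norm_mul, mul_pow]
  refine Finset.sum_congr rfl fun k _ => ?_
  ring

theorem ZMod.sum_mul_eq_sum_dft {q : ℕ} [NeZero q] (f F : ZMod q → ℂ) :
    ∑ x, f x * F x = (q : ℂ)⁻¹ * ∑ k, ZMod.dft F k * ZMod.dft f (-k) := by
  have hF (x : ZMod q) : F x = (q : ℂ)⁻¹ * ∑ k, stdAddChar (k * x) * ZMod.dft F k := by
    conv_lhs => rw [← ZMod.dft.symm_apply_apply F]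
    rw [invDFT_apply]
    simp only [smul_eq_mul]
  conv_lhs => enter [2, x]; rw [hF x]
  simp only [dft_apply f, smul_eq_mul, Finset.mul_sum]
  rw [Finset.sum_comm]
  refine Finset.sum_congr rfl fun k _ => Finset.sum_congr rfl fun x _ => ?_
  rw [mul_neg, neg_neg, mul_comm k x]
  ring

theorem ZMod.sum_inv_val_mul_sub_val (q : ℕ) [NeZero q] :
    ∑ k ∈ (Finset.univ : Finset (ZMod q)).erase 0, (k.val * (q - k.val : ℝ))⁻¹ =
      2 / q * ∑ n ∈ Finset.Ico 1 q, (n : ℝ)⁻¹ := by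
  rw [sum_erase_zero_eq_sum_Ico (fun n => (n * (q - n : ℝ))⁻¹), div_mul_eq_mul_div,
    ← sum_Ico_inv_add_inv_sub, Finset.sum_div]
  refine Finset.sum_congr rfl fun n hn => ?_
  obtain ⟨h1, h2⟩ := Finset.mem_Ico.mp hn
  have h3 : (n : ℝ) ≠ 0 := by exact_mod_cast (show n ≠ 0 by lia)
  have h4 : (q - n : ℝ) ≠ 0 := sub_ne_zero.mpr (by exact_mod_cast h2.ne')
  have h5 : (q : ℝ) ≠ 0 := by exact_mod_cast NeZero.ne q
  field_simp
  ring

theorem DirichletCharacter.IsPrimitive.norm_sum_mul_sq_le_energy {q : ℕ} [NeZero q] (hq : q ≠ 1)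
    {χ : DirichletCharacter ℂ q} (hχ : χ.IsPrimitive) (F : ZMod q → ℂ) :
    ‖∑ x, χ x * F x‖ ^ 2 ≤ 2 / q * (∑ n ∈ Finset.Ico 1 q, (n : ℝ)⁻¹) * ZMod.energy F := by
  have hq0 : (0 : ℝ) < q := by exact_mod_cast NeZero.pos q
  have : Fact (1 < q) := ⟨by have := NeZero.ne q; lia⟩
  have hzero : ZMod.dft (χ : ZMod q → ℂ) (-0) = 0 := by
    rw [hχ.fourierTransform_eq_inv_mul_gaussSum, neg_zero, neg_zero, MulChar.map_zero, zero_mul]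
  have hw (k : ZMod q) (hk : k ∈ (Finset.univ : Finset (ZMod q)).erase 0) :
      0 < k.val * (q - k.val : ℝ) := by
    have h1 : 0 < (k.val : ℝ) := by
      exact_mod_cast Nat.pos_of_ne_zero ((ZMod.val_ne_zero k).mpr (Finset.ne_of_mem_erase hk))
    have h2 : (k.val : ℝ) < q := by exact_mod_cast k.val_lt
    exact mul_pos h1 (sub_pos.mpr h2)
  rw [ZMod.sum_mul_eq_sum_dft, ← Finset.sum_erase Finset.univ (a := 0) (by rw [hzero, mul_zero]),
    norm_mul, mul_pow]
  have h1 : ‖∑ k ∈ Finset.univ.erase 0, ZMod.dft F k * ZMod.dft χ (-k)‖ ^ 2 ≤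
      (∑ k ∈ Finset.univ.erase 0, ‖ZMod.dft F k‖ ^ 2 * (k.val * (q - k.val : ℝ))) *
      ∑ k ∈ (Finset.univ : Finset (ZMod q)).erase 0, q * (k.val * (q - k.val : ℝ))⁻¹ := by
    refine (pow_le_pow_left₀ (norm_nonneg _) (norm_sum_le _ _) 2).trans ?_
    refine Finset.sum_sq_le_sum_mul_sum_of_sq_le_mul _
      (fun k hk => mul_nonneg (by positivity) (hw k hk).le)
      (fun k hk => mul_nonneg hq0.le (inv_nonneg.mpr (hw k hk).le)) fun k hk => ?_
    have hk0 := (hw k hk).ne'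
    rw [norm_mul, mul_pow, mul_assoc (‖ZMod.dft F k‖ ^ 2), mul_left_comm _ (q : ℝ),
      mul_inv_cancel₀ hk0, mul_one]
    exact mul_le_mul_of_nonneg_left (hχ.norm_dft_sq_le _) (by positivity)
  have h2 : ∑ k ∈ Finset.univ.erase 0, ‖ZMod.dft F k‖ ^ 2 * (k.val * (q - k.val : ℝ)) =
      q * ZMod.energy F := by
    rw [← ZMod.sum_norm_dft_sq_mul_eq_energy, Finset.sum_erase]
    simp
  rw [h2, ← Finset.mul_sum, ZMod.sum_inv_val_mul_sub_val] at h1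
  rw [norm_inv, Complex.norm_natCast]
  refine (mul_le_mul_of_nonneg_left h1 (by positivity)).trans_eq ?_
  field_simp

/-- The number of elements of `s` in the residue class `x`. -/
def residueCount {q : ℕ} (s : Finset ℕ) (x : ZMod q) : ℕ :=
  (s.filter fun n : ℕ => (n : ZMod q) = x).card

theorem sum_mul_residueCount {q : ℕ} [NeZero q] (s : Finset ℕ) (g : ZMod q → ℂ) :
    ∑ x, g x * residueCount s x = ∑ n ∈ s, g n := by
  simp only [residueCount, Finset.card_filter, Nat.cast_sum, Finset.mul_sum]
  rw [Finset.sum_comm]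
  refine Finset.sum_congr rfl fun n _ => ?_
  simp

theorem residueCount_range_two_mul_le {q : ℕ} [NeZero q] (x : ZMod q) :
    residueCount (Finset.range (2 * q)) x ≤ 2 := by
  simp only [residueCount, Finset.card_filter]
  have h : ∑ n ∈ Finset.range q, (if (n : ZMod q) = x then 1 else 0) = 1 := by
    rw [Finset.sum_eq_single x.val]
    · simp
    · intro n hn hne
      rw [if_neg]
      rintro rfl
      exact hne (ZMod.val_cast_of_lt (Finset.mem_range.mp hn)).symm
    · intro h
      exact absurd (Finset.mem_range.mpr x.val_lt) h
  rw [two_mul, Finset.sum_range_add]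
  simp [h]

theorem sum_residueCount_le_two {q : ℕ} [NeZero q] {ι : Type*} (s : Finset ι) (I : ι → Finset ℕ)
    (hI : (s : Set ι).PairwiseDisjoint I) (hsub : ∀ j ∈ s, I j ⊆ Finset.range (2 * q))
    (x : ZMod q) : ∑ j ∈ s, residueCount (I j) x ≤ 2 := by
  classical
  refine le_trans ?_ (residueCount_range_two_mul_le x)
  have h : ∑ j ∈ s, residueCount (I j) x = residueCount (s.biUnion I) x := by
    simp only [residueCount, Finset.card_filter]
    rw [Finset.sum_biUnion hI]
  rw [h]
  exact Finset.card_le_card (Finset.filter_subset_filter _ (Finset.biUnion_subset.mpr hsub))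

theorem residueCount_Ioc_add_one_sub {q : ℕ} (N h : ℕ) (x : ZMod q) :
    (residueCount (Finset.Ioc N (N + h)) (x + 1) - residueCount (Finset.Ioc N (N + h)) x : ℝ) =
      (if (N : ZMod q) = x then 1 else 0) - (if ((N + h : ℕ) : ZMod q) = x then 1 else 0) := by
  simp only [residueCount, Finset.card_filter]
  induction h with
  | zero => simp
  | succ h ih =>
    rw [← add_assoc, Finset.sum_Ioc_succ_top (by lia), Finset.sum_Ioc_succ_top (by lia)]
    have : (((N + h + 1 : ℕ) : ZMod q) = x + 1) ↔ ((N + h : ℕ) : ZMod q) = x := by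
      rw [Nat.cast_succ, add_left_inj]
    simp only [this]
    push_cast at ih ⊢
    linarith

theorem sum_abs_residueCount_add_natCast_sub_le {q : ℕ} [NeZero q] (N h L : ℕ) :
    ∑ x : ZMod q, |(residueCount (Finset.Ioc N (N + h)) (x + (L : ZMod q)) -
      residueCount (Finset.Ioc N (N + h)) x : ℝ)| ≤ 2 * L := by
  set f : ZMod q → ℝ := fun x => residueCount (Finset.Ioc N (N + h)) x with hf
  change ∑ x : ZMod q, |f (x + (L : ZMod q)) - f x| ≤ 2 * L
  have hone : ∑ x : ZMod q, |f (x + 1) - f x| ≤ 2 := by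
    simp only [hf, residueCount_Ioc_add_one_sub]
    refine (Finset.sum_le_sum fun x _ => abs_sub _ _).trans ?_
    rw [Finset.sum_add_distrib]
    simp only [apply_ite abs, abs_one, abs_zero, Finset.sum_ite_eq, Finset.mem_univ, if_true]
    norm_num
  induction L with
  | zero => simp
  | succ L ih =>
    have htri (x : ZMod q) : |f (x + ((L + 1 : ℕ) : ZMod q)) - f x| ≤
        |f (x + (L : ZMod q) + 1) - f (x + (L : ZMod q))| +
          |f (x + (L : ZMod q)) - f x| := by
      rw [Nat.cast_succ, ← add_assoc]
      exact abs_sub_le _ _ _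
    refine (Finset.sum_le_sum fun x _ => htri x).trans ?_
    have hshift : ∑ x, |f (x + (L : ZMod q) + 1) - f (x + (L : ZMod q))| =
        ∑ x, |f (x + 1) - f x| :=
      Equiv.sum_comp (Equiv.addRight (L : ZMod q)) (fun x => |f (x + 1) - f x|)
    rw [Finset.sum_add_distrib, hshift]
    push_cast
    linarith

theorem sum_abs_residueCount_add_sub_le {q : ℕ} [NeZero q] (N h : ℕ) (L : ZMod q) :
    ∑ x : ZMod q, |(residueCount (Finset.Ioc N (N + h)) (x + L) -
      residueCount (Finset.Ioc N (N + h)) x : ℝ)| ≤ 2 * min (L.val : ℝ) (q - L.val) := by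
  rw [mul_min_of_nonneg _ _ zero_le_two]
  refine le_min ?_ ?_
  · simpa using sum_abs_residueCount_add_natCast_sub_le (q := q) N h L.val
  · have h1 := sum_abs_residueCount_add_natCast_sub_le (q := q) N h (q - L.val)
    rw [Nat.cast_sub L.val_lt.le, Nat.cast_sub L.val_lt.le, ZMod.natCast_self,
      ZMod.natCast_zmod_val, zero_sub] at h1
    refine le_trans (le_of_eq ?_) h1
    refine Fintype.sum_equiv (Equiv.addRight L) _ _ fun x => ?_
    rw [Equiv.coe_addRight, add_neg_cancel_right, abs_sub_comm]

theorem norm_sum_mul_ofReal_sq_le {ι : Type*} (s : Finset ι) (c : ι → ℂ) (d : ι → ℝ) :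
    ‖∑ j ∈ s, c j * d j‖ ^ 2 ≤ (∑ j ∈ s, |d j|) * ∑ j ∈ s, ‖c j‖ ^ 2 * |d j| := by
  refine (pow_le_pow_left₀ (norm_nonneg _) (norm_sum_le _ _) 2).trans ?_
  refine Finset.sum_sq_le_sum_mul_sum_of_sq_le_mul _ (fun _ _ => abs_nonneg _)
    (fun _ _ => by positivity) fun j _ => le_of_eq ?_
  rw [norm_mul, Complex.norm_real, Real.norm_eq_abs]
  ring

section StepFunction

variable {q : ℕ} [NeZero q] {ι : Type*} {s : Finset ι} {N h : ι → ℕ}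

theorem sum_norm_translate_sub_sq_le
    (hdisj : (s : Set ι).PairwiseDisjoint fun j => Finset.Ioc (N j) (N j + h j))
    (hsub : ∀ j ∈ s, Finset.Ioc (N j) (N j + h j) ⊆ Finset.range (2 * q)) (c : ι → ℂ)
    (L : ZMod q) :
    ∑ x, ‖∑ j ∈ s, c j * residueCount (Finset.Ioc (N j) (N j + h j)) (x + L) -
        ∑ j ∈ s, c j * residueCount (Finset.Ioc (N j) (N j + h j)) x‖ ^ 2 ≤
      8 * min (L.val : ℝ) (q - L.val) * ∑ j ∈ s, ‖c j‖ ^ 2 := by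
  set f : ι → ZMod q → ℝ := fun j x => residueCount (Finset.Ioc (N j) (N j + h j)) x with hf
  have hle (x : ZMod q) : ∑ j ∈ s, f j x ≤ 2 := by
    simp only [hf]
    exact_mod_cast sum_residueCount_le_two s _ hdisj hsub x
  have hpt (x : ZMod q) : ‖∑ j ∈ s, c j * residueCount (Finset.Ioc (N j) (N j + h j)) (x + L) -
        ∑ j ∈ s, c j * residueCount (Finset.Ioc (N j) (N j + h j)) x‖ ^ 2 ≤
      4 * ∑ j ∈ s, ‖c j‖ ^ 2 * |f j (x + L) - f j x| := by
    have h1 := norm_sum_mul_ofReal_sq_le s c fun j => f j (x + L) - f j x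
    have h2 : ∑ j ∈ s, |f j (x + L) - f j x| ≤ 4 := by
      have h3 : ∑ j ∈ s, |f j (x + L) - f j x| ≤ ∑ j ∈ s, (f j (x + L) + f j x) := by
        refine Finset.sum_le_sum fun j _ => (abs_sub _ _).trans_eq ?_
        simp [hf]
      rw [Finset.sum_add_distrib] at h3
      linarith [hle x, hle (x + L)]
    rw [← Finset.sum_sub_distrib]
    refine le_trans (le_of_eq ?_) (h1.trans (mul_le_mul_of_nonneg_right h2
      (Finset.sum_nonneg fun _ _ => by positivity)))
    simp only [hf, Complex.ofReal_sub, Complex.ofReal_natCast, mul_sub]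
  refine (Finset.sum_le_sum fun x _ => hpt x).trans ?_
  rw [← Finset.mul_sum, Finset.sum_comm, Finset.mul_sum, Finset.mul_sum]
  refine Finset.sum_le_sum fun j _ => ?_
  rw [← Finset.mul_sum]
  have := mul_le_mul_of_nonneg_left (sum_abs_residueCount_add_sub_le (N j) (h j) L)
    (sq_nonneg ‖c j‖)
  linarith

theorem energy_sum_residueCount_le
    (hdisj : (s : Set ι).PairwiseDisjoint fun j => Finset.Ioc (N j) (N j + h j))
    (hsub : ∀ j ∈ s, Finset.Ioc (N j) (N j + h j) ⊆ Finset.range (2 * q)) (c : ι → ℂ) :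
    ZMod.energy (q := q) (fun x => ∑ j ∈ s, c j * residueCount (Finset.Ioc (N j) (N j + h j)) x) ≤
      q ^ 2 * (∑ n ∈ Finset.Ico 1 q, (n : ℝ)⁻¹) * ∑ j ∈ s, ‖c j‖ ^ 2 := by
  have hq : (0 : ℝ) < q := by exact_mod_cast NeZero.pos q
  set A := ∑ j ∈ s, ‖c j‖ ^ 2
  have hA : 0 ≤ A := Finset.sum_nonneg fun _ _ => by positivity
  have hterm (L : ZMod q) (hL : L ∈ Finset.univ.erase 0) :
      (∑ x, ‖∑ j ∈ s, c j * residueCount (Finset.Ioc (N j) (N j + h j)) (x + L) -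
        ∑ j ∈ s, c j * residueCount (Finset.Ioc (N j) (N j + h j)) x‖ ^ 2) /
        ‖ZMod.stdAddChar L - 1‖ ^ 2 ≤
      q ^ 2 / 2 * A * ((L.val : ℝ)⁻¹ + (q - L.val : ℝ)⁻¹) := by
    have h1 : 0 < (L.val : ℝ) := by
      exact_mod_cast Nat.pos_of_ne_zero ((ZMod.val_ne_zero L).mpr (Finset.ne_of_mem_erase hL))
    have h2 : 0 < (q - L.val : ℝ) := sub_pos.mpr (by exact_mod_cast L.val_lt)
    have h3 := ZMod.four_mul_min_div_le_norm_stdAddChar_sub_one L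
    have h4 := sum_norm_translate_sub_sq_le hdisj hsub c L
    have h5 : (min (L.val : ℝ) (q - L.val))⁻¹ ≤ (L.val : ℝ)⁻¹ + (q - L.val : ℝ)⁻¹ := by
      rcases min_choice (L.val : ℝ) (q - L.val) with h | h <;> rw [h] <;>
        linarith [inv_pos.mpr h1, inv_pos.mpr h2]
    set m := min (L.val : ℝ) (q - L.val)
    have hm : 0 < m := lt_min h1 h2
    calc _ ≤ 8 * m * A / (4 * m / q) ^ 2 := by gcongr
      _ = q ^ 2 / 2 * A * m⁻¹ := by field_simp; ring
      _ ≤ _ := by gcongr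
  refine (Finset.sum_le_sum hterm).trans_eq ?_
  rw [← Finset.mul_sum,
    ZMod.sum_erase_zero_eq_sum_Ico (fun n => (n : ℝ)⁻¹ + (q - n : ℝ)⁻¹), sum_Ico_inv_add_inv_sub]
  ring

/-- The large sieve type bound for a primitive character over disjoint intervals. -/
theorem DirichletCharacter.IsPrimitive.sum_norm_sum_Ioc_sq_le (hq : 3 ≤ q)
    {χ : DirichletCharacter ℂ q} (hχ : χ.IsPrimitive)
    (hdisj : (s : Set ι).PairwiseDisjoint fun j => Finset.Ioc (N j) (N j + h j))
    (hsub : ∀ j ∈ s, Finset.Ioc (N j) (N j + h j) ⊆ Finset.range (2 * q)) :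
    ∑ j ∈ s, ‖∑ n ∈ Finset.Ioc (N j) (N j + h j), χ (n : ZMod q)‖ ^ 2 ≤
      8 * q * Real.log q ^ 2 := by
  have hq0 : (0 : ℝ) < q := by exact_mod_cast NeZero.pos q
  set S : ι → ℂ := fun j => ∑ n ∈ Finset.Ioc (N j) (N j + h j), χ (n : ZMod q) with hS
  set A := ∑ j ∈ s, ‖S j‖ ^ 2 with hA
  have hA0 : 0 ≤ A := Finset.sum_nonneg fun _ _ => by positivity
  set c : ι → ℂ := fun j => (starRingEnd ℂ) (S j) with hc
  have h1 := hχ.norm_sum_mul_sq_le_energy (by lia) fun x =>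
    ∑ j ∈ s, c j * residueCount (Finset.Ioc (N j) (N j + h j)) x
  have h2 : ∑ x, χ x * ∑ j ∈ s, c j * residueCount (Finset.Ioc (N j) (N j + h j)) x =
      (A : ℂ) := by
    simp only [Finset.mul_sum]
    rw [Finset.sum_comm, hA, Complex.ofReal_sum]
    refine Finset.sum_congr rfl fun j _ => ?_
    rw [Complex.ofReal_pow, ← Complex.conj_mul', hc, hS]
    simp only
    rw [← sum_mul_residueCount,
      Finset.mul_sum]
    exact Finset.sum_congr rfl fun x _ => mul_left_comm _ _ _
  have h3 := energy_sum_residueCount_le hdisj hsub c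
  have h4 : ∑ j ∈ s, ‖c j‖ ^ 2 = A := by simp only [hc, RCLike.norm_conj, hA]
  rw [h4] at h3
  rw [h2, Complex.norm_real, Real.norm_of_nonneg hA0] at h1
  have h5 := sum_Ico_inv_le_two_mul_log hq
  set B := ∑ n ∈ Finset.Ico 1 q, (n : ℝ)⁻¹
  have hB : 0 ≤ B := Finset.sum_nonneg fun _ _ => by positivity
  have h6 : A ^ 2 ≤ 2 * q * B ^ 2 * A := by
    refine h1.trans ((mul_le_mul_of_nonneg_left h3 (by positivity)).trans_eq ?_)
    field_simp
  have h7 : A ≤ 2 * q * B ^ 2 := by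
    by_contra! hlt
    have : 0 ≤ 2 * q * B ^ 2 := by positivity
    nlinarith
  calc A ≤ 2 * q * B ^ 2 := h7
    _ ≤ 2 * q * (2 * Real.log q) ^ 2 := by gcongr
    _ = 8 * q * Real.log q ^ 2 := by ring

end StepFunction

theorem add_le_of_spaced {H J : ℕ} {N : ℕ → ℕ}
    (hN : ∀ j, 1 ≤ j → j < J → N j + H ≤ N (j + 1)) {i k : ℕ} (hi : 1 ≤ i) (hik : i < k)
    (hk : k ≤ J) : N i + H ≤ N k := by
  induction k, hik using Nat.le_induction with
  | base => exact hN i hi (by lia)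
  | succ k hik ih =>
    have := ih (by lia)
    have := hN k (by lia) (by lia)
    lia

/-- Pólya–Vinogradov-type mean value estimate: for `q ≥ 3`, a primitive Dirichlet character
`χ` mod `q`, `H ≤ q`, and `H`-spaced points `0 ≤ N_1 < ⋯ < N_J < q`,
`∑_j max_{1 ≤ h ≤ H} |S(N_j; h)|² ≤ C q (log q)²` with an absolute constant `C`. -/
theorem stmt_6 :
    ∃ C : ℝ, ∀ (q : ℕ), 3 ≤ q →
      ∀ (χ : DirichletCharacter ℂ q), DirichletCharacter.IsPrimitive χ →
      ∀ (H : ℕ) (hH : 1 ≤ H), H ≤ q →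
      ∀ (J : ℕ) (N : ℕ → ℕ),
        (∀ j, 1 ≤ j → j < J → N j + H ≤ N (j + 1)) →
        (∀ j, 1 ≤ j → j ≤ J → N j < q) →
        ∑ j ∈ Finset.Icc 1 J,
            (Finset.Icc 1 H).sup' (Finset.nonempty_Icc.mpr hH)
              (fun h => ‖∑ n ∈ Finset.Ioc (N j) (N j + h), χ (n : ZMod q)‖ ^ 2)
          ≤ C * (q : ℝ) * Real.log q ^ 2 := by
  refine ⟨8, fun q hq χ hχ H hH hHq J N hspaced hlt => ?_⟩
  have : NeZero q := ⟨by lia⟩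
  choose h hmem heq using fun j => Finset.exists_mem_eq_sup' (Finset.nonempty_Icc.mpr hH)
    (fun h => ‖∑ n ∈ Finset.Ioc (N j) (N j + h), χ (n : ZMod q)‖ ^ 2)
  simp only [heq]
  have hle (j : ℕ) : h j ≤ H := (Finset.mem_Icc.mp (hmem j)).2
  refine hχ.sum_norm_sum_Ioc_sq_le hq ?_ ?_
  · intro i hi k hk hik
    simp only [Finset.coe_Icc, Set.mem_Icc] at hi hk
    simp only [Function.onFun, Finset.disjoint_left, Finset.mem_Ioc]
    intro n hn hn'
    have h1 := hle i
    have h2 := hle k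
    rcases lt_or_gt_of_ne hik with hlt' | hlt'
    · have := add_le_of_spaced hspaced hi.1 hlt' hk.2
      lia
    · have := add_le_of_spaced hspaced hk.1 hlt' hi.2
      lia
  · intro j hj n hn
    rw [Finset.mem_Icc] at hj
    rw [Finset.mem_Ioc] at hn
    have h1 := hlt j hj.1 hj.2
    have h2 := hle j
    rw [Finset.mem_range]
    lia
end

section
/- Let ε > 0. There is a constant C = C(ε) such that for every prime ℓ, every positive integer n with 5n ≤ ℓ, and every nonzero residue s ∈ F_ℓ, the number of pairs (a, r) of nonzero integers with 1 ≤ |a| ≤ n, 1 ≤ |r| ≤ ℓ/(5n), and a·r ≡ s (mod ℓ) is at most C · ℓ^ε. -/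
/-- For fixed `ε > 0` the ratio of `k + 1` to `(p ^ k) ^ ε`, for `p ≥ 2`, is bounded. -/
lemma exists_succ_le_mul_pow_rpow (ε : ℝ) (hε : 0 < ε) :
    ∃ A : ℝ, 1 ≤ A ∧ ∀ p k : ℕ, 2 ≤ p → (k + 1 : ℝ) ≤ A * ((p : ℝ) ^ k) ^ ε := by
  have hlog : 0 < ε * Real.log 2 := mul_pos hε (Real.log_pos one_lt_two)
  refine ⟨max 1 (ε * Real.log 2)⁻¹, le_max_left _ _, fun p k hp => ?_⟩
  set A := max 1 (ε * Real.log 2)⁻¹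
  have hA : 1 ≤ A := le_max_left _ _
  have hA' : 1 ≤ A * (ε * Real.log 2) := by
    calc (1 : ℝ) = (ε * Real.log 2)⁻¹ * (ε * Real.log 2) := (inv_mul_cancel₀ hlog.ne').symm
      _ ≤ _ := by gcongr; exact le_max_right _ _
  have hp' : (2 : ℝ) ≤ p := by exact_mod_cast hp
  have hexp : 1 + k * (ε * Real.log 2) ≤ ((p : ℝ) ^ k) ^ ε := by
    calc 1 + k * (ε * Real.log 2) ≤ Real.exp (k * (ε * Real.log 2)) := by
          rw [add_comm]; exact Real.add_one_le_exp _
      _ = ((2 : ℝ) ^ k) ^ ε := by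
          rw [Real.rpow_def_of_pos (by positivity), Real.log_pow]
          ring_nf
      _ ≤ _ := by gcongr
  calc (k + 1 : ℝ) ≤ A + k * (A * (ε * Real.log 2)) := by
        nlinarith [(Nat.cast_nonneg k : (0 : ℝ) ≤ k)]
    _ = A * (1 + k * (ε * Real.log 2)) := by ring
    _ ≤ _ := by gcongr

/-- For fixed `ε > 0`, one has `k + 1 ≤ (p ^ k) ^ ε` as soon as `p` is large. -/
lemma exists_succ_le_pow_rpow (ε : ℝ) (hε : 0 < ε) :
    ∃ P : ℕ, ∀ p k : ℕ, P ≤ p → (k + 1 : ℝ) ≤ ((p : ℝ) ^ k) ^ ε := by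
  refine ⟨⌈(2 : ℝ) ^ ε⁻¹⌉₊, fun p k hp => ?_⟩
  have hp' : (2 : ℝ) ^ ε⁻¹ ≤ p := Nat.ceil_le.mp hp
  have h2 : (2 : ℝ) ≤ (p : ℝ) ^ ε := by
    calc (2 : ℝ) = ((2 : ℝ) ^ ε⁻¹) ^ ε := (Real.rpow_inv_rpow zero_le_two hε.ne').symm
      _ ≤ _ := by gcongr
  calc (k + 1 : ℝ) ≤ 2 ^ k := by exact_mod_cast Nat.lt_two_pow_self
    _ ≤ ((p : ℝ) ^ ε) ^ k := by gcongr
    _ = _ := Real.rpow_pow_comm p.cast_nonneg ε k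

/-- The divisor bound: the number of divisors of `n` is `O(n ^ ε)` for every `ε > 0`. -/
theorem exists_card_divisors_le_mul_rpow (ε : ℝ) (hε : 0 < ε) :
    ∃ C : ℝ, 0 ≤ C ∧ ∀ n : ℕ, n ≠ 0 → (n.divisors.card : ℝ) ≤ C * (n : ℝ) ^ ε := by
  obtain ⟨A, hA, hsmall⟩ := exists_succ_le_mul_pow_rpow ε hε
  obtain ⟨P, hlarge⟩ := exists_succ_le_pow_rpow ε hε
  refine ⟨A ^ P, by positivity, fun n hn => ?_⟩
  have hn' : (n : ℝ) = ∏ p ∈ n.primeFactors, (p : ℝ) ^ n.factorization p := by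
    conv_lhs => rw [← Nat.prod_factorization_pow_eq_self hn]
    simp [Finsupp.prod]
  have hconst : ∏ p ∈ n.primeFactors, (if p < P then A else 1) ≤ A ^ P := by
    rw [← Finset.prod_filter, Finset.prod_const]
    refine pow_le_pow_right₀ hA ?_
    calc (n.primeFactors.filter (· < P)).card ≤ (Finset.range P).card :=
          Finset.card_le_card fun p hp => by simpa using (Finset.mem_filter.mp hp).2
      _ = P := Finset.card_range P
  calc (n.divisors.card : ℝ) = ∏ p ∈ n.primeFactors, (n.factorization p + 1 : ℝ) := by
        rw [Nat.card_divisors hn]; push_cast; rfl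
    _ ≤ ∏ p ∈ n.primeFactors,
          ((if p < P then A else 1) * ((p : ℝ) ^ n.factorization p) ^ ε) := by
        refine Finset.prod_le_prod (fun p _ => by positivity) fun p hp => ?_
        split_ifs with h
        · exact hsmall p _ (Nat.prime_of_mem_primeFactors hp).two_le
        · simpa using hlarge p _ (not_lt.mp h)
    _ = (∏ p ∈ n.primeFactors, (if p < P then A else 1)) * (n : ℝ) ^ ε := by
        rw [Finset.prod_mul_distrib, Real.finsetProd_rpow _ _ fun p _ => by positivity, ← hn']
    _ ≤ _ := by gcongr

/-- A nonzero integer `m` has at most `2 d(|m|)` factorizations as a product of two integers. -/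
lemma card_le_two_mul_card_divisors {m : ℤ} (hm : m ≠ 0) (S : Finset (ℤ × ℤ))
    (hS : ∀ x ∈ S, x.1 * x.2 = m) : S.card ≤ 2 * m.natAbs.divisors.card := by
  have hcard : (m.natAbs.divisors ×ˢ (Finset.univ : Finset Bool)).card
      = 2 * m.natAbs.divisors.card := by
    rw [Finset.card_product, Finset.card_univ, Fintype.card_bool, mul_comm]
  rw [← hcard]
  refine Finset.card_le_card_of_injOn (fun x => (x.1.natAbs, decide (x.1 < 0))) ?_ ?_
  · intro x hx
    have : x.1 ∣ m := ⟨x.2, (hS x hx).symm⟩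
    simpa [hm, lt_or_ge] using this
  · intro x hx y hy hxy
    have h1 : x.1 = y.1 := by
      simp only [Prod.mk.injEq, decide_eq_decide] at hxy
      omega
    have hx1 : x.1 ≠ 0 := left_ne_zero_of_mul (hS x hx ▸ hm)
    have h2 : x.1 * x.2 = x.1 * y.2 := by rw [hS x hx, h1, hS y hy]
    exact Prod.ext h1 (mul_left_cancel₀ hx1 h2)

/-- Divisor-type bound: for a prime `ℓ`, `5n ≤ ℓ`, and a nonzero residue `s ∈ F_ℓ`, the
number of pairs `(a, r)` of nonzero integers with `|a| ≤ n`, `|r| ≤ ℓ/(5n)` and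
`a·r ≡ s (mod ℓ)` is at most `C(ε) ℓ^ε`. -/
theorem stmt_9 (ε : ℝ) (hε : 0 < ε) :
    ∃ C : ℝ, ∀ (ℓ : ℕ), ℓ.Prime → ∀ (n : ℕ), 0 < n → 5 * n ≤ ℓ →
      ∀ (s : ZMod ℓ), s ≠ 0 →
      (((Finset.Icc (-(n : ℤ)) (n : ℤ) ×ˢ
            Finset.Icc (-⌊(ℓ : ℝ) / (5 * n)⌋) ⌊(ℓ : ℝ) / (5 * n)⌋).filter
          (fun x : ℤ × ℤ => x.1 ≠ 0 ∧ x.2 ≠ 0 ∧ (x.1 : ZMod ℓ) * (x.2 : ZMod ℓ) = s)).card : ℝ)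
        ≤ C * (ℓ : ℝ) ^ ε := by
  obtain ⟨C, hC, hdiv⟩ := exists_card_divisors_le_mul_rpow ε hε
  refine ⟨2 * C, fun ℓ hℓ n hn _ s _ => ?_⟩
  set S := (Finset.Icc (-(n : ℤ)) (n : ℤ) ×ˢ
      Finset.Icc (-⌊(ℓ : ℝ) / (5 * n)⌋) ⌊(ℓ : ℝ) / (5 * n)⌋).filter
    (fun x : ℤ × ℤ => x.1 ≠ 0 ∧ x.2 ≠ 0 ∧ (x.1 : ZMod ℓ) * (x.2 : ZMod ℓ) = s) with hSdef
  have hmem : ∀ x ∈ S, 5 * |x.1 * x.2| ≤ ℓ ∧ x.1 * x.2 ≠ 0 ∧ ((x.1 * x.2 : ℤ) : ZMod ℓ) = s := by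
    intro x hx
    simp only [hSdef, Finset.mem_filter, Finset.mem_product, Finset.mem_Icc, ← abs_le] at hx
    obtain ⟨⟨h1, h2⟩, h3, h4, h5⟩ := hx
    refine ⟨?_, mul_ne_zero h3 h4, by push_cast; exact h5⟩
    have hn' : (0 : ℝ) < n := by exact_mod_cast hn
    have h1' : |(x.1 : ℝ)| ≤ n := by exact_mod_cast h1
    have h2' : |(x.2 : ℝ)| ≤ ℓ / (5 * n) := by exact_mod_cast Int.le_floor.mp h2
    have : 5 * |(x.1 * x.2 : ℝ)| ≤ ℓ := by
      calc 5 * |(x.1 * x.2 : ℝ)| = 5 * (|(x.1 : ℝ)| * |(x.2 : ℝ)|) := by rw [abs_mul]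
        _ ≤ 5 * (n * (ℓ / (5 * n))) := by gcongr
        _ = ℓ := by field_simp
    exact_mod_cast this
  rcases S.eq_empty_or_nonempty with hS | ⟨y, hy⟩
  · rw [hS, Finset.card_empty, Nat.cast_zero]
    positivity
  obtain ⟨hy1, hy2, hy3⟩ := hmem y hy
  have hprod : ∀ x ∈ S, x.1 * x.2 = y.1 * y.2 := by
    intro x hx
    obtain ⟨hx1, -, hx3⟩ := hmem x hx
    have hdvd : (ℓ : ℤ) ∣ x.1 * x.2 - y.1 * y.2 := by
      rw [← ZMod.intCast_eq_intCast_iff_dvd_sub, hx3, hy3]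
    have hlt : |x.1 * x.2 - y.1 * y.2| < ℓ := by
      have := abs_sub (x.1 * x.2) (y.1 * y.2)
      have : (0 : ℤ) < ℓ := by exact_mod_cast hℓ.pos
      linarith
    exact sub_eq_zero.mp (Int.eq_zero_of_abs_lt_dvd hdvd hlt)
  have hle : (y.1 * y.2).natAbs ≤ ℓ := by
    rw [Int.abs_eq_natAbs] at hy1
    omega
  calc (S.card : ℝ) ≤ 2 * ((y.1 * y.2).natAbs.divisors.card : ℝ) := by
        exact_mod_cast card_le_two_mul_card_divisors hy2 S hprod
    _ ≤ 2 * (C * ((y.1 * y.2).natAbs : ℝ) ^ ε) := by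
        gcongr
        exact hdiv _ (Int.natAbs_ne_zero.mpr hy2)
    _ ≤ 2 * (C * (ℓ : ℝ) ^ ε) := by gcongr
    _ = 2 * C * (ℓ : ℝ) ^ ε := by ring
end
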